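/- There exists a generic subset R of the Hydrogen-atom bound-state space 𝓗 such that for every ψ ∈ R and every q ∈ (0,1), the spectral measure μ_ψ satisfies D⁻_{μ_ψ}(q) = 0 and D⁺_{μ_ψ}(q) = 1/3. -/

import Mathlib

open MeasureTheory Filter Set Topology ENNReal

noncomputable section

/-- `I_μ(q, ε) = ∫ μ(B(x,ε))^{q-1} dμ(x)`, integrated over `{x : μ(B(x,ε)) > 0}`. -/
def fracIntegral (μ : Measure ℝ) (q ε : ℝ) : ℝ≥0∞ :=
  ∫⁻ x in {x : ℝ | 0 < μ (Ioo (x - ε) (x + ε))}, μ (Ioo (x - ε) (x + ε)) ^ (q - 1) ∂μ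

/-- lower q-generalized fractal dimension. -/
def Dlower (μ : Measure ℝ) (q : ℝ) : ℝ :=
  liminf (fun ε : ℝ => Real.log (fracIntegral μ q ε).toReal / ((q - 1) * Real.log ε)) (𝓝[>] 0)

/-- upper q-generalized fractal dimension. -/
def Dupper (μ : Measure ℝ) (q : ℝ) : ℝ :=
  limsup (fun ε : ℝ => Real.log (fracIntegral μ q ε).toReal / ((q - 1) * Real.log ε)) (𝓝[>] 0)

/-- index set of the hydrogen orbitals. -/
structure HIndex where
  n : ℕ
  l : ℕ
  m : ℤ
  hn : 1 ≤ n
  hl : l < n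
  hm : -(l : ℤ) ≤ m ∧ m ≤ (l : ℤ)

instance : Fact ((1 : ℝ≥0∞) ≤ 2) := ⟨one_le_two⟩

/-- the bound-state space -/
abbrev Hspace := lp (fun _ : HIndex => ℂ) 2

/-- eigenvalues of the hydrogen Hamiltonian -/
def lam (Λ : ℝ) (n : ℕ) : ℝ := -Λ / (n : ℝ) ^ 2

/-- spectral measure of a bound state -/
def specMeasure (Λ : ℝ) (ψ : Hspace) : Measure ℝ :=
  Measure.sum fun i : HIndex =>
    ENNReal.ofReal (‖ψ i‖ ^ 2) • Measure.dirac (lam Λ i.n)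

theorem sum_rpow_le_card_rpow_mul {ι : Type*} (s : Finset ι) (f : ι → ℝ≥0∞) {q : ℝ}
    (hq : q ∈ Ioo (0 : ℝ) 1) :
    ∑ i ∈ s, f i ^ q ≤ (s.card : ℝ≥0∞) ^ (1 - q) * (∑ i ∈ s, f i) ^ q := by
  have hq0 : q ≠ 0 := hq.1.ne'
  have h := ENNReal.rpow_le_rpow (ENNReal.rpow_sum_le_const_mul_sum_rpow s (fun i => f i ^ q)
    ((one_le_inv₀ hq.1).2 hq.2.le)) hq.1.le
  have hf : ∀ i ∈ s, (f i ^ q) ^ q⁻¹ = f i := fun i _ => by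
    rw [← ENNReal.rpow_mul, mul_inv_cancel₀ hq0, ENNReal.rpow_one]
  rwa [Finset.sum_congr rfl hf, ENNReal.mul_rpow_of_nonneg _ _ hq.1.le, ← ENNReal.rpow_mul,
    ← ENNReal.rpow_mul, inv_mul_cancel₀ hq0, ENNReal.rpow_one, sub_mul, inv_mul_cancel₀ hq0,
    one_mul] at h

/-- A set contained in every `ε`-ball centred on it contributes at most `μ(C)^q` to `I_μ(q, ε)`. -/
theorem setLIntegral_ball_rpow_le (μ : Measure ℝ) [IsFiniteMeasure μ] {q ε : ℝ}
    (hq : q ∈ Ioo (0 : ℝ) 1) {C : Set ℝ} (hC : MeasurableSet C)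
    (hCε : ∀ x ∈ C, C ⊆ Ioo (x - ε) (x + ε)) :
    ∫⁻ x in C, μ (Ioo (x - ε) (x + ε)) ^ (q - 1) ∂μ ≤ μ C ^ q := by
  rcases eq_or_ne (μ C) 0 with h0 | h0
  · rw [setLIntegral_measure_zero _ _ h0]
    exact zero_le
  calc ∫⁻ x in C, μ (Ioo (x - ε) (x + ε)) ^ (q - 1) ∂μ
      ≤ ∫⁻ _ in C, μ C ^ (q - 1) ∂μ := by
        refine setLIntegral_mono' hC fun x hx => ?_
        rw [← neg_sub 1 q, ENNReal.rpow_neg, ENNReal.rpow_neg, ENNReal.inv_le_inv]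
        exact ENNReal.rpow_le_rpow (measure_mono (hCε x hx)) (by linarith [hq.2])
    _ = μ C ^ q := by
        rw [setLIntegral_const]
        nth_rewrite 2 [← ENNReal.rpow_one (μ C)]
        rw [← ENNReal.rpow_add _ _ h0 (measure_ne_top μ C), sub_add_cancel]

theorem setLIntegral_ball_rpow_biUnion_le (μ : Measure ℝ) [IsFiniteMeasure μ] {q ε : ℝ}
    (hq : q ∈ Ioo (0 : ℝ) 1) (s : Finset ℕ) {C : ℕ → Set ℝ} {E : Set ℝ}
    (hC : ∀ i, MeasurableSet (C i)) (hCE : ∀ i ∈ s, C i ⊆ E)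
    (hd : (s : Set ℕ).PairwiseDisjoint C) (hCε : ∀ i, ∀ x ∈ C i, C i ⊆ Ioo (x - ε) (x + ε)) :
    ∫⁻ x in ⋃ i ∈ s, C i, μ (Ioo (x - ε) (x + ε)) ^ (q - 1) ∂μ
      ≤ (s.card : ℝ≥0∞) ^ (1 - q) * μ E ^ q := by
  calc ∫⁻ x in ⋃ i ∈ s, C i, μ (Ioo (x - ε) (x + ε)) ^ (q - 1) ∂μ
      = ∑ i ∈ s, ∫⁻ x in C i, μ (Ioo (x - ε) (x + ε)) ^ (q - 1) ∂μ :=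
        lintegral_biUnion_finset hd (fun i _ => hC i) _
    _ ≤ ∑ i ∈ s, μ (C i) ^ q :=
        Finset.sum_le_sum fun i _ => setLIntegral_ball_rpow_le μ hq (hC i) (hCε i)
    _ ≤ (s.card : ℝ≥0∞) ^ (1 - q) * (∑ i ∈ s, μ (C i)) ^ q :=
        sum_rpow_le_card_rpow_mul s _ hq
    _ ≤ _ := by
        rw [← measure_biUnion_finset hd fun i _ => hC i]
        gcongr
        · exact hq.1.le
        · exact iUnion₂_subset hCE

theorem lam_lt_lam {Λ : ℝ} (hΛ : 0 < Λ) {m n : ℕ} (hm : 1 ≤ m) (hmn : m < n) :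
    lam Λ m < lam Λ n := by
  have hm' : (0 : ℝ) < m := by exact_mod_cast hm
  have hmn' : (m : ℝ) < n := by exact_mod_cast hmn
  unfold lam
  rw [neg_div, neg_div, neg_lt_neg_iff]
  gcongr

theorem lam_le_lam {Λ : ℝ} (hΛ : 0 < Λ) {m n : ℕ} (hm : 1 ≤ m) (hmn : m ≤ n) :
    lam Λ m ≤ lam Λ n := by
  rcases hmn.eq_or_lt with rfl | h
  · exact le_rfl
  · exact (lam_lt_lam hΛ hm h).le

theorem lam_neg {Λ : ℝ} (hΛ : 0 < Λ) {n : ℕ} (hn : 1 ≤ n) : lam Λ n < 0 := by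
  have hn' : (0 : ℝ) < n := by exact_mod_cast hn
  unfold lam
  rw [neg_div, neg_lt_zero]
  positivity

/-- Consecutive eigenvalues are at least `Λ / (2 n³)` apart. -/
theorem lam_add_le_lam_succ {Λ : ℝ} (hΛ : 0 < Λ) {n : ℕ} (hn : 1 ≤ n) :
    lam Λ n + Λ / (2 * n ^ 3) ≤ lam Λ (n + 1) := by
  have hn' : (1 : ℝ) ≤ n := by exact_mod_cast hn
  have h0 : (0 : ℝ) < n := by linarith
  have key : lam Λ (n + 1) - (lam Λ n + Λ / (2 * n ^ 3))
      = Λ * (3 * n ^ 2 - 1) / (2 * n ^ 3 * (n + 1) ^ 2) := by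
    unfold lam
    push_cast
    field_simp
    ring
  have : 0 ≤ Λ * (3 * (n : ℝ) ^ 2 - 1) / (2 * n ^ 3 * (n + 1) ^ 2) := by
    apply div_nonneg _ (by positivity)
    apply mul_nonneg hΛ.le
    nlinarith
  linarith

theorem specMeasure_apply (Λ : ℝ) (ψ : Hspace) {S : Set ℝ} (hS : MeasurableSet S) :
    specMeasure Λ ψ S
      = ∑' i : HIndex, ENNReal.ofReal (‖ψ i‖ ^ 2) * S.indicator 1 (lam Λ i.n) := by
  simp [specMeasure, Measure.sum_apply _ hS, Measure.dirac_apply' _ hS]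

theorem tsum_ofReal_norm_sq (ψ : Hspace) :
    ∑' i : HIndex, ENNReal.ofReal (‖ψ i‖ ^ 2) = ENNReal.ofReal (‖ψ‖ ^ 2) := by
  have h := lp.hasSum_norm (by norm_num : 0 < (2 : ℝ≥0∞).toReal) ψ
  simp only [ENNReal.toReal_ofNat, Real.rpow_ofNat] at h
  rw [← h.tsum_eq, ENNReal.ofReal_tsum_of_nonneg (fun i => by positivity) h.summable]

instance (Λ : ℝ) (ψ : Hspace) : IsFiniteMeasure (specMeasure Λ ψ) := by
  refine ⟨?_⟩
  rw [specMeasure_apply Λ ψ MeasurableSet.univ]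
  simp only [indicator_univ, Pi.one_apply, mul_one, tsum_ofReal_norm_sq]
  exact ENNReal.ofReal_lt_top

theorem ofReal_norm_sq_le_specMeasure (Λ : ℝ) (ψ : Hspace) (i : HIndex) :
    ENNReal.ofReal (‖ψ i‖ ^ 2) ≤ specMeasure Λ ψ {lam Λ i.n} := by
  rw [specMeasure_apply Λ ψ (measurableSet_singleton _)]
  refine le_trans ?_ (ENNReal.le_tsum i)
  simp

theorem specMeasure_Ioi_le {Λ : ℝ} (hΛ : 0 < Λ) (ψ φ : Hspace) {K : ℕ}
    (hφ : ∀ i : HIndex, K < i.n → φ i = 0) :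
    specMeasure Λ ψ (Ioi (lam Λ K)) ≤ ENNReal.ofReal (‖ψ - φ‖ ^ 2) := by
  rw [specMeasure_apply Λ ψ measurableSet_Ioi, ← tsum_ofReal_norm_sq]
  refine ENNReal.tsum_le_tsum fun i => ?_
  by_cases hi : K < i.n
  · rw [lp.coeFn_sub, Pi.sub_apply, hφ i hi, sub_zero]
    refine mul_le_of_le_one_right zero_le ?_
    exact indicator_le_self' (f := (1 : ℝ → ℝ≥0∞)) (fun _ _ => zero_le) _
  · have : lam Λ i.n ∉ Ioi (lam Λ K) := by
      simpa using lam_le_lam hΛ i.hn (not_lt.1 hi)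
    simp [this]

theorem ae_specMeasure (Λ : ℝ) (ψ : Hspace) :
    ∀ᵐ x ∂specMeasure Λ ψ, ∃ n, 1 ≤ n ∧ x = lam Λ n := by
  have hS : {x | ∃ n, 1 ≤ n ∧ x = lam Λ n}.Countable := by
    refine (countable_range (lam Λ)).mono ?_
    rintro x ⟨n, -, rfl⟩
    exact mem_range_self n
  rw [ae_iff]
  change specMeasure Λ ψ {x | ∃ n, 1 ≤ n ∧ x = lam Λ n}ᶜ = 0
  rw [specMeasure_apply Λ ψ hS.measurableSet.compl, ENNReal.tsum_eq_zero]
  intro i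
  have : lam Λ i.n ∉ {x | ∃ n, 1 ≤ n ∧ x = lam Λ n}ᶜ := fun h => h ⟨i.n, i.hn, rfl⟩
  simp [this]

/-- Cover the first `K` eigenvalues by points and the others by `N` intervals of length `ε`. -/
theorem fracIntegral_specMeasure_le {Λ : ℝ} (hΛ : 0 < Λ) (ψ : Hspace) {q ε : ℝ}
    (hq : q ∈ Ioo (0 : ℝ) 1) (hε : 0 < ε) {K N : ℕ}
    (hK : 1 ≤ K) (hN : Λ / (K : ℝ) ^ 2 ≤ N * ε) :
    fracIntegral (specMeasure Λ ψ) q ε ≤ (K : ℝ≥0∞) ^ (1 - q) * specMeasure Λ ψ univ ^ q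
      + (N : ℝ≥0∞) ^ (1 - q) * specMeasure Λ ψ (Ioi (lam Λ K)) ^ q := by
  set μ := specMeasure Λ ψ
  set C : ℕ → Set ℝ := fun k => {lam Λ (k + 1)} with hC
  set J : ℕ → Set ℝ := fun j => Ioc (lam Λ K + j * ε) (lam Λ K + (j + 1) * ε) with hJ
  set A := ⋃ i ∈ Finset.range K, C i
  set B := ⋃ i ∈ Finset.range N, J i
  have hA : ∫⁻ x in A, μ (Ioo (x - ε) (x + ε)) ^ (q - 1) ∂μ ≤ (K : ℝ≥0∞) ^ (1 - q) * μ univ ^ q := by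
    have := setLIntegral_ball_rpow_biUnion_le μ hq (ε := ε) (Finset.range K) (C := C) (E := univ)
      (fun i => measurableSet_singleton _) (fun _ _ => subset_univ _) ?_ ?_
    · rwa [Finset.card_range] at this
    · intro i _ j _ hij
      rw [Function.onFun, disjoint_singleton]
      rcases lt_or_gt_of_ne hij with h | h
      · exact (lam_lt_lam hΛ (by omega) (by omega)).ne
      · exact (lam_lt_lam hΛ (by omega) (by omega)).ne'
    · rintro i x hx y hy
      rw [hC, mem_singleton_iff] at hx hy
      constructor <;> linarith
  have hB : ∫⁻ x in B, μ (Ioo (x - ε) (x + ε)) ^ (q - 1) ∂μ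
      ≤ (N : ℝ≥0∞) ^ (1 - q) * μ (Ioi (lam Λ K)) ^ q := by
    have := setLIntegral_ball_rpow_biUnion_le μ hq (ε := ε) (Finset.range N) (C := J)
      (E := Ioi (lam Λ K)) (fun i => measurableSet_Ioc) ?_ ?_ ?_
    · rwa [Finset.card_range] at this
    · intro i _ x hx
      have : 0 ≤ i * ε := by positivity
      have := hx.1
      simp only [mem_Ioi]
      linarith
    · have : Pairwise (Function.onFun Disjoint J) := by
        have h := pairwise_disjoint_Ioc_add_zsmul (lam Λ K) ε
        intro i j hij
        have := h (show (i : ℤ) ≠ j by exact_mod_cast hij)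
        simpa [Function.onFun, hJ] using this
      exact this.set_pairwise _
    · rintro i x hx y hy
      simp only [hJ, mem_Ioc] at hx hy
      constructor <;> linarith [hx.1, hx.2, hy.1, hy.2]
  have hcover : ∀ᵐ x ∂μ, x ∈ A ∪ B := by
    filter_upwards [ae_specMeasure Λ ψ] with x hx
    obtain ⟨n, hn, rfl⟩ := hx
    by_cases hnK : n ≤ K
    · left
      simp only [A, hC, mem_iUnion, Finset.mem_range]
      exact ⟨n - 1, by omega, by rw [Nat.sub_add_cancel hn]; rfl⟩
    · right
      have h1 := lam_lt_lam hΛ hK (not_le.1 hnK)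
      have h2 := lam_neg hΛ hn
      set y := (lam Λ n - lam Λ K) / ε with hy
      have hy0 : 0 < y := div_pos (by linarith) hε
      have hyε : y * ε = lam Λ n - lam Λ K := div_mul_cancel₀ _ hε.ne'
      have hyN : y ≤ N := by
        rw [hy, div_le_iff₀ hε]
        have : lam Λ K = -(Λ / (K : ℝ) ^ 2) := neg_div _ _
        linarith
      have hc := Nat.ceil_pos.2 hy0
      simp only [B, hJ, mem_iUnion, Finset.mem_range]
      refine ⟨⌈y⌉₊ - 1, by have := Nat.ceil_le.2 hyN; omega, ?_⟩
      have hcast : ((⌈y⌉₊ - 1 : ℕ) : ℝ) = ⌈y⌉₊ - 1 := Nat.cast_pred hc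
      have ha := mul_lt_mul_of_pos_right (Nat.ceil_lt_add_one hy0.le) hε
      have hb := mul_le_mul_of_nonneg_right (Nat.le_ceil y) hε.le
      rw [hcast]
      constructor <;> linarith
  calc fracIntegral μ q ε ≤ ∫⁻ x, μ (Ioo (x - ε) (x + ε)) ^ (q - 1) ∂μ :=
        setLIntegral_le_lintegral _ _
    _ = ∫⁻ x in A ∪ B, μ (Ioo (x - ε) (x + ε)) ^ (q - 1) ∂μ := by
        rw [Measure.restrict_eq_self_of_ae_mem hcover]
    _ ≤ _ := (lintegral_union_le _ _ _).trans (add_le_add hA hB)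

theorem fracIntegral_specMeasure_ne_top {Λ : ℝ} (hΛ : 0 < Λ) (ψ : Hspace) {q ε : ℝ}
    (hq : q ∈ Ioo (0 : ℝ) 1) (hε : 0 < ε) : fracIntegral (specMeasure Λ ψ) q ε ≠ ⊤ := by
  have h1q : 0 ≤ 1 - q := by linarith [hq.2]
  have hN : Λ / ((1 : ℕ) : ℝ) ^ 2 ≤ (⌈Λ / ε⌉₊ : ℝ) * ε := by
    rw [Nat.cast_one, one_pow, div_one, ← div_le_iff₀ hε]
    exact Nat.le_ceil _
  refine ne_top_of_le_ne_top ?_ (fracIntegral_specMeasure_le hΛ ψ hq hε le_rfl hN)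
  refine ENNReal.add_ne_top.2 ⟨ENNReal.mul_ne_top ?_ ?_, ENNReal.mul_ne_top ?_ ?_⟩
  · exact ENNReal.rpow_ne_top_of_nonneg h1q (ENNReal.natCast_ne_top _)
  · exact ENNReal.rpow_ne_top_of_nonneg hq.1.le (measure_ne_top _ _)
  · exact ENNReal.rpow_ne_top_of_nonneg h1q (ENNReal.natCast_ne_top _)
  · exact ENNReal.rpow_ne_top_of_nonneg hq.1.le (measure_ne_top _ _)

theorem toReal_fracIntegral_specMeasure_le {Λ : ℝ} (hΛ : 0 < Λ) (ψ : Hspace) {q ε : ℝ}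
    (hq : q ∈ Ioo (0 : ℝ) 1) (hε : 0 < ε) {K N : ℕ} (hK : 1 ≤ K)
    (hN : Λ / (K : ℝ) ^ 2 ≤ N * ε) :
    (fracIntegral (specMeasure Λ ψ) q ε).toReal ≤
      (K : ℝ) ^ (1 - q) * (specMeasure Λ ψ).real univ ^ q
        + (N : ℝ) ^ (1 - q) * (specMeasure Λ ψ).real (Ioi (lam Λ K)) ^ q := by
  have h1q : 0 ≤ 1 - q := by linarith [hq.2]
  have htop : ∀ (n : ℕ) (S : Set ℝ), (n : ℝ≥0∞) ^ (1 - q) * specMeasure Λ ψ S ^ q ≠ ⊤ :=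
    fun n S => ENNReal.mul_ne_top
      (ENNReal.rpow_ne_top_of_nonneg h1q (ENNReal.natCast_ne_top _))
      (ENNReal.rpow_ne_top_of_nonneg hq.1.le (measure_ne_top _ _))
  have h := ENNReal.toReal_mono (ENNReal.add_ne_top.2 ⟨htop _ _, htop _ _⟩)
    (fracIntegral_specMeasure_le hΛ ψ hq hε hK hN)
  rwa [ENNReal.toReal_add (htop _ _) (htop _ _), ENNReal.toReal_mul, ENNReal.toReal_mul,
    ← ENNReal.toReal_rpow, ← ENNReal.toReal_rpow, ← ENNReal.toReal_rpow, ← ENNReal.toReal_rpow,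
    ENNReal.toReal_natCast, ENNReal.toReal_natCast] at h

/-- `I_μ(q, ε)` is bounded below by the contribution of any finite set of atoms. -/
theorem sum_le_fracIntegral (μ : Measure ℝ) {q ε : ℝ} (hε : 0 < ε) (s : Finset ℝ)
    (hs : ∀ x ∈ s, 0 < μ {x}) :
    ∑ x ∈ s, μ (Ioo (x - ε) (x + ε)) ^ (q - 1) * μ {x} ≤ fracIntegral μ q ε := by
  rw [← lintegral_finset s fun x => μ (Ioo (x - ε) (x + ε)) ^ (q - 1)]
  refine lintegral_mono_set fun x hx => (hs x hx).trans_le (measure_mono ?_)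
  rw [singleton_subset_iff]
  constructor <;> linarith

theorem exists_pos_le_toReal_fracIntegral {Λ : ℝ} (hΛ : 0 < Λ) (ψ : Hspace) {q : ℝ}
    (hq : q ∈ Ioo (0 : ℝ) 1) {x : ℝ} (hx : 0 < specMeasure Λ ψ {x}) :
    ∃ c > 0, ∀ ε > 0, c ≤ (fracIntegral (specMeasure Λ ψ) q ε).toReal := by
  set μ := specMeasure Λ ψ
  have h1q : 0 ≤ 1 - q := by linarith [hq.2]
  have hμ : 0 < μ univ := hx.trans_le (measure_mono (subset_univ _))
  have hpos : 0 < μ univ ^ (q - 1) * μ {x} :=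
    ENNReal.mul_pos (ENNReal.rpow_pos hμ (measure_ne_top _ _)).ne' hx.ne'
  have htop : μ univ ^ (q - 1) * μ {x} ≠ ⊤ :=
    ENNReal.mul_ne_top (ENNReal.rpow_ne_top_of_ne_zero hμ.ne' (measure_ne_top _ _))
      (measure_ne_top _ _)
  refine ⟨_, ENNReal.toReal_pos hpos.ne' htop, fun ε hε =>
    ENNReal.toReal_mono (fracIntegral_specMeasure_ne_top hΛ ψ hq hε) ?_⟩
  have h := sum_le_fracIntegral μ (q := q) hε {x} (by simpa using hx)
  rw [Finset.sum_singleton] at h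
  refine le_trans ?_ h
  gcongr ?_ * _
  rw [← neg_sub 1 q, ENNReal.rpow_neg, ENNReal.rpow_neg, ENNReal.inv_le_inv]
  exact ENNReal.rpow_le_rpow (measure_mono (subset_univ _)) h1q

theorem lam_eq_of_mem_Ioo {Λ : ℝ} (hΛ : 0 < Λ) {K m n : ℕ} (hm : 1 ≤ m) (hmK : m ≤ K)
    (hn : 1 ≤ n)
    (h : lam Λ n ∈ Ioo (lam Λ m - Λ / (2 * K ^ 3)) (lam Λ m + Λ / (2 * K ^ 3))) :
    n = m := by
  have gap : ∀ j : ℕ, 1 ≤ j → j ≤ K → Λ / (2 * (K : ℝ) ^ 3) ≤ Λ / (2 * (j : ℝ) ^ 3) := by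
    intro j hj hjK
    have : (0 : ℝ) < j := by exact_mod_cast hj
    gcongr
  rcases lt_trichotomy n m with hlt | heq | hgt
  · have h1 := lam_add_le_lam_succ hΛ hn
    have h2 := lam_le_lam hΛ (by omega) (show n + 1 ≤ m from hlt)
    have h3 := gap n hn (by omega)
    linarith [h.1]
  · exact heq
  · have h1 := lam_add_le_lam_succ hΛ hm
    have h2 := lam_le_lam hΛ (by omega) (show m + 1 ≤ n from hgt)
    have h3 := gap m hm hmK
    linarith [h.2]

/-- At the scale `Λ / (2 K³)` the first `K` eigenvalues are isolated. -/
theorem mul_rpow_le_toReal_fracIntegral {Λ : ℝ} (hΛ : 0 < Λ) (ψ : Hspace) {q δ : ℝ}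
    (hq : q ∈ Ioo (0 : ℝ) 1) {K : ℕ} (hK : 1 ≤ K) (hδ : 0 < δ)
    (h : ∀ k < K, δ ≤ (specMeasure Λ ψ).real {lam Λ (k + 1)}) :
    K * δ ^ q ≤ (fracIntegral (specMeasure Λ ψ) q (Λ / (2 * K ^ 3))).toReal := by
  set μ := specMeasure Λ ψ
  have hK' : (0 : ℝ) < K := by exact_mod_cast hK
  have hε : 0 < Λ / (2 * (K : ℝ) ^ 3) := by positivity
  have hδμ : ∀ k < K, ENNReal.ofReal δ ≤ μ {lam Λ (k + 1)} := fun k hk =>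
    ENNReal.ofReal_le_of_le_toReal (h k hk)
  have hpos : ∀ k < K, 0 < μ {lam Λ (k + 1)} := fun k hk =>
    (ENNReal.ofReal_pos.2 hδ).trans_le (hδμ k hk)
  have hinj : ∀ i ∈ Finset.range K, ∀ j ∈ Finset.range K,
      lam Λ (i + 1) = lam Λ (j + 1) → i = j := by
    intro i _ j _ hij
    by_contra hne
    rcases lt_or_gt_of_ne hne with hlt | hlt
    · exact (lam_lt_lam hΛ (by omega) (by omega)).ne hij
    · exact (lam_lt_lam hΛ (by omega) (by omega)).ne' hij
  have hsum := sum_le_fracIntegral μ (q := q) hε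
    ((Finset.range K).image fun k => lam Λ (k + 1)) (by simpa using hpos)
  rw [Finset.sum_image hinj] at hsum
  have hle : ∑ _k ∈ Finset.range K, ENNReal.ofReal δ ^ q
      ≤ fracIntegral μ q (Λ / (2 * K ^ 3)) := by
    refine (Finset.sum_le_sum fun k hk => ?_).trans hsum
    rw [Finset.mem_range] at hk
    have hball : μ (Ioo (lam Λ (k + 1) - Λ / (2 * K ^ 3)) (lam Λ (k + 1) + Λ / (2 * K ^ 3)))
        = μ {lam Λ (k + 1)} := by
      refine measure_congr ?_
      filter_upwards [ae_specMeasure Λ ψ] with x hx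
      obtain ⟨n, hn, rfl⟩ := hx
      refine propext ⟨fun hmem => ?_, fun hmem => ?_⟩
      · exact congrArg (lam Λ) (lam_eq_of_mem_Ioo hΛ (by omega) hk hn hmem)
      · have heq : lam Λ n = lam Λ (k + 1) := hmem
        change lam Λ n ∈ Ioo _ _
        rw [heq]
        constructor <;> linarith
    rw [hball]
    nth_rewrite 2 [← ENNReal.rpow_one (μ {lam Λ (k + 1)})]
    rw [← ENNReal.rpow_add _ _ (hpos k hk).ne' (measure_ne_top _ _), sub_add_cancel]
    exact ENNReal.rpow_le_rpow (hδμ k hk) hq.1.le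
  have h2 := ENNReal.toReal_mono (fracIntegral_specMeasure_ne_top hΛ ψ hq hε) hle
  rwa [Finset.sum_const, Finset.card_range, nsmul_eq_mul, ENNReal.toReal_mul,
    ENNReal.toReal_natCast, ← ENNReal.toReal_rpow, ENNReal.toReal_ofReal hδ.le] at h2

theorem liminf_eq_of_eventually_of_frequently {ι : Type*} {l : Filter ι} [l.NeBot] {f : ι → ℝ}
    {a : ℝ} (h1 : ∀ δ > 0, ∀ᶠ i in l, a - δ ≤ f i) (h2 : ∀ δ > 0, ∃ᶠ i in l, f i ≤ a + δ) :
    liminf f l = a := by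
  refine le_antisymm (le_of_forall_pos_le_add fun δ hδ => ?_)
    (le_of_forall_pos_sub_le fun δ hδ => ?_)
  · exact liminf_le_of_frequently_le (h2 δ hδ) (isBoundedUnder_of_eventually_ge (h1 1 one_pos))
  · exact le_liminf_of_le (IsCoboundedUnder.of_frequently_le (h2 1 one_pos)) (h1 δ hδ)

theorem limsup_eq_of_eventually_of_frequently {ι : Type*} {l : Filter ι} [l.NeBot] {f : ι → ℝ}
    {a : ℝ} (h1 : ∀ δ > 0, ∀ᶠ i in l, f i ≤ a + δ) (h2 : ∀ δ > 0, ∃ᶠ i in l, a - δ ≤ f i) :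
    limsup f l = a := by
  refine le_antisymm (le_of_forall_pos_le_add fun δ hδ => ?_)
    (le_of_forall_pos_sub_le fun δ hδ => ?_)
  · exact limsup_le_of_le (IsCoboundedUnder.of_frequently_ge (h2 1 one_pos)) (h1 δ hδ)
  · exact le_limsup_of_frequently_le (h2 δ hδ) (isBoundedUnder_of_eventually_le (h1 1 one_pos))

theorem toReal_fracIntegral_le_rpow {Λ : ℝ} (hΛ : 0 < Λ) (ψ : Hspace) {q ε : ℝ}
    (hq : q ∈ Ioo (0 : ℝ) 1) (hε : ε ∈ Ioo (0 : ℝ) 1) :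
    (fracIntegral (specMeasure Λ ψ) q ε).toReal ≤
      ((2 : ℝ) ^ (1 - q) + (Λ + 1) ^ (1 - q)) * (specMeasure Λ ψ).real univ ^ q
        * (ε ^ (-(1 / 3) : ℝ)) ^ (1 - q) := by
  have h1q : 0 ≤ 1 - q := by linarith [hq.2]
  set M := (specMeasure Λ ψ).real univ
  set a : ℝ := ε ^ (-(1 / 3) : ℝ) with ha
  have ha1 : 1 ≤ a := Real.one_le_rpow_of_pos_of_le_one_of_nonpos hε.1 hε.2.le (by norm_num)
  have ha3 : a ^ 3 * ε = 1 := by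
    rw [ha, ← Real.rpow_natCast, ← Real.rpow_mul hε.1.le]
    norm_num [Real.rpow_neg_one, hε.1.ne']
  have ha0 : 0 < a := by linarith
  have hKa := Nat.le_ceil a
  have hKa' := Nat.ceil_lt_add_one ha0.le
  have hNa := Nat.le_ceil (Λ * a)
  have hNa' := Nat.ceil_lt_add_one (mul_pos hΛ ha0).le
  have hN : Λ / (⌈a⌉₊ : ℝ) ^ 2 ≤ (⌈Λ * a⌉₊ : ℝ) * ε := by
    calc Λ / (⌈a⌉₊ : ℝ) ^ 2 ≤ Λ / a ^ 2 := by gcongr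
      _ = Λ * a * ε := by
        rw [div_eq_iff (by positivity)]
        linear_combination -Λ * ha3
      _ ≤ _ := mul_le_mul_of_nonneg_right hNa hε.1.le
  refine (toReal_fracIntegral_specMeasure_le hΛ ψ hq hε.1 (Nat.ceil_pos.2 ha0) hN).trans ?_
  have hK2 : (⌈a⌉₊ : ℝ) ^ (1 - q) ≤ (2 : ℝ) ^ (1 - q) * a ^ (1 - q) := by
    rw [← Real.mul_rpow (by norm_num) ha0.le]
    exact Real.rpow_le_rpow (by positivity) (by linarith) h1q
  have hN2 : (⌈Λ * a⌉₊ : ℝ) ^ (1 - q) ≤ (Λ + 1) ^ (1 - q) * a ^ (1 - q) := by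
    rw [← Real.mul_rpow (by linarith) ha0.le]
    exact Real.rpow_le_rpow (by positivity) (by linarith) h1q
  have hT : (specMeasure Λ ψ).real (Ioi (lam Λ ⌈a⌉₊)) ^ q ≤ M ^ q :=
    Real.rpow_le_rpow measureReal_nonneg (measureReal_mono (subset_univ _)) hq.1.le
  have hM : 0 ≤ M ^ q := Real.rpow_nonneg measureReal_nonneg _
  calc _ ≤ (2 : ℝ) ^ (1 - q) * a ^ (1 - q) * M ^ q + (Λ + 1) ^ (1 - q) * a ^ (1 - q) * M ^ q := by
        gcongr
    _ = _ := by ring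

/-- The quotient whose lower and upper limits are the generalized dimensions. -/
def dimQuot (μ : Measure ℝ) (q ε : ℝ) : ℝ :=
  Real.log (fracIntegral μ q ε).toReal / ((q - 1) * Real.log ε)

theorem tendsto_const_div_mul_log {q : ℝ} (hq : q < 1) (c : ℝ) :
    Tendsto (fun ε : ℝ => c / ((q - 1) * Real.log ε)) (𝓝[>] 0) (𝓝 0) :=
  tendsto_const_nhds.div_atTop
    (Real.tendsto_log_nhdsGT_zero.const_mul_atBot_of_neg (by linarith))

theorem eventually_le_dimQuot {Λ : ℝ} (hΛ : 0 < Λ) (ψ : Hspace) {q : ℝ}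
    (hq : q ∈ Ioo (0 : ℝ) 1) {x : ℝ} (hx : 0 < specMeasure Λ ψ {x}) {δ : ℝ} (hδ : 0 < δ) :
    ∀ᶠ ε in 𝓝[>] 0, 0 - δ ≤ dimQuot (specMeasure Λ ψ) q ε := by
  obtain ⟨c, hc, hcF⟩ := exists_pos_le_toReal_fracIntegral hΛ ψ hq hx
  filter_upwards [(tendsto_const_div_mul_log hq.2 (Real.log c)).eventually_const_le
    (show 0 - δ < 0 by linarith), Ioo_mem_nhdsGT one_pos] with ε h hε
  refine h.trans ?_
  have : 0 < (q - 1) * Real.log ε :=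
    mul_pos_of_neg_of_neg (by linarith [hq.2]) (Real.log_neg hε.1 hε.2)
  unfold dimQuot
  gcongr
  exact hcF ε hε.1

theorem eventually_dimQuot_le {Λ : ℝ} (hΛ : 0 < Λ) (ψ : Hspace) {q : ℝ}
    (hq : q ∈ Ioo (0 : ℝ) 1) {x : ℝ} (hx : 0 < specMeasure Λ ψ {x}) {δ : ℝ} (hδ : 0 < δ) :
    ∀ᶠ ε in 𝓝[>] 0, dimQuot (specMeasure Λ ψ) q ε ≤ 1 / 3 + δ := by
  obtain ⟨c, hc, hcF⟩ := exists_pos_le_toReal_fracIntegral hΛ ψ hq hx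
  set C := ((2 : ℝ) ^ (1 - q) + (Λ + 1) ^ (1 - q)) * (specMeasure Λ ψ).real univ ^ q
  filter_upwards [(tendsto_const_div_mul_log hq.2 (Real.log C)).eventually_le_const hδ,
    Ioo_mem_nhdsGT one_pos] with ε h hε
  have hlog := Real.log_neg hε.1 hε.2
  have hpos : 0 < (q - 1) * Real.log ε := mul_pos_of_neg_of_neg (by linarith [hq.2]) hlog
  have hF := toReal_fracIntegral_le_rpow hΛ ψ hq hε
  have hF0 : 0 < (fracIntegral (specMeasure Λ ψ) q ε).toReal := hc.trans_le (hcF ε hε.1)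
  have ha0 : 0 < ε ^ (-(1 / 3) : ℝ) := Real.rpow_pos_of_pos hε.1 _
  have hC : C ≠ 0 := by
    rintro h0
    change _ ≤ C * _ at hF
    rw [h0, zero_mul] at hF
    linarith
  have hle := Real.log_le_log hF0 hF
  rw [Real.log_mul hC (Real.rpow_pos_of_pos ha0 _).ne', Real.log_rpow ha0,
    Real.log_rpow hε.1] at hle
  calc dimQuot (specMeasure Λ ψ) q ε
      ≤ (Real.log C + (1 - q) * (-(1 / 3) * Real.log ε)) / ((q - 1) * Real.log ε) := by
        unfold dimQuot
        gcongr
    _ = 1 / 3 + Real.log C / ((q - 1) * Real.log ε) := by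
        have h1 : q - 1 ≠ 0 := by linarith [hq.2]
        have h2 := hlog.ne
        field_simp
        ring
    _ ≤ 1 / 3 + δ := by linarith

theorem frequently_dimQuot_le {Λ : ℝ} (hΛ : 0 < Λ) (ψ : Hspace) {q : ℝ}
    (hq : q ∈ Ioo (0 : ℝ) 1) {x : ℝ} (hx : 0 < specMeasure Λ ψ {x})
    (hψ : ∃ᶠ K : ℕ in atTop, (specMeasure Λ ψ).real (Ioi (lam Λ K)) ≤ Real.exp (-(K : ℝ) ^ 2))
    {δ : ℝ} (hδ : 0 < δ) :
    ∃ᶠ ε in 𝓝[>] 0, dimQuot (specMeasure Λ ψ) q ε ≤ 0 + δ := by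
  obtain ⟨c, hc, hcF⟩ := exists_pos_le_toReal_fracIntegral hΛ ψ hq hx
  have h1q : 0 < 1 - q := by linarith [hq.2]
  set M := (specMeasure Λ ψ).real univ
  have hM : 0 ≤ M ^ q := Real.rpow_nonneg measureReal_nonneg _
  set C := M ^ q + (Λ + 1) with hC
  have hC0 : 0 < C := by positivity
  have hscale : Tendsto (fun K : ℕ => Real.exp (-(K : ℝ))) atTop (𝓝[>] 0) := by
    refine tendsto_nhdsWithin_iff.2 ⟨?_, Eventually.of_forall fun K => Real.exp_pos _⟩
    exact Real.tendsto_exp_neg_atTop_nhds_zero.comp tendsto_natCast_atTop_atTop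
  have hlim : Tendsto (fun K : ℕ => (Real.log K + Real.log C) / ((1 - q) * K)) atTop (𝓝 0) := by
    have h1 : Tendsto (fun t : ℝ => (Real.log t / t + Real.log C / t) / (1 - q)) atTop (𝓝 0) := by
      have := ((Real.isLittleO_log_id_atTop.tendsto_div_nhds_zero).add
        (tendsto_const_nhds (x := Real.log C).div_atTop tendsto_id)).div_const (1 - q)
      simpa using this
    refine (h1.comp tendsto_natCast_atTop_atTop).congr fun K => ?_
    rw [Function.comp_apply, ← add_div, div_div, mul_comm]
  refine hscale.frequently (hψ.mp ?_)
  filter_upwards [hlim.eventually_le_const hδ, eventually_ge_atTop 1,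
    tendsto_natCast_atTop_atTop.eventually_ge_atTop (1 / q)] with K hK hK1 hKq hT
  have hK1' : (1 : ℝ) ≤ K := by exact_mod_cast hK1
  have hexp : 1 ≤ Real.exp K := Real.one_le_exp (by positivity)
  have hN : Λ / (K : ℝ) ^ 2 ≤ (⌈Λ * Real.exp K⌉₊ : ℝ) * Real.exp (-K) := by
    calc Λ / (K : ℝ) ^ 2 ≤ Λ := div_le_self hΛ.le (one_le_pow₀ hK1')
      _ = Λ * Real.exp K * Real.exp (-K) := by rw [mul_assoc, ← Real.exp_add]; simp
      _ ≤ _ := mul_le_mul_of_nonneg_right (Nat.le_ceil _) (Real.exp_pos _).le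
  have hF := toReal_fracIntegral_specMeasure_le hΛ ψ hq (Real.exp_pos _) hK1 hN
  have hN2 : (⌈Λ * Real.exp K⌉₊ : ℝ) ^ (1 - q) ≤ (Λ + 1) * Real.exp K := by
    have h1 : (1 : ℝ) ≤ (Λ + 1) * Real.exp K := by nlinarith
    have h2 := Nat.ceil_lt_add_one (mul_pos hΛ (Real.exp_pos K)).le
    calc (⌈Λ * Real.exp K⌉₊ : ℝ) ^ (1 - q) ≤ ((Λ + 1) * Real.exp K) ^ (1 - q) :=
          Real.rpow_le_rpow (by positivity) (by linarith) h1q.le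
      _ ≤ ((Λ + 1) * Real.exp K) ^ (1 : ℝ) :=
          Real.rpow_le_rpow_of_exponent_le h1 (by linarith [hq.1])
      _ = _ := Real.rpow_one _
  have hT2 : (specMeasure Λ ψ).real (Ioi (lam Λ K)) ^ q ≤ Real.exp (-K) := by
    refine (Real.rpow_le_rpow measureReal_nonneg hT hq.1.le).trans ?_
    rw [← Real.exp_mul, Real.exp_le_exp]
    rw [div_le_iff₀ hq.1] at hKq
    nlinarith
  have hK2 : (K : ℝ) ^ (1 - q) ≤ K := by
    calc (K : ℝ) ^ (1 - q) ≤ (K : ℝ) ^ (1 : ℝ) :=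
          Real.rpow_le_rpow_of_exponent_le hK1' (by linarith [hq.1])
      _ = K := Real.rpow_one _
  have hF2 : (fracIntegral (specMeasure Λ ψ) q (Real.exp (-K))).toReal ≤ K * C := by
    calc _ ≤ _ := hF
      _ ≤ K * M ^ q + (Λ + 1) * Real.exp K * Real.exp (-K) := by
        gcongr
      _ = K * M ^ q + (Λ + 1) := by rw [mul_assoc (Λ + 1), ← Real.exp_add]; simp
      _ ≤ K * C := by rw [hC]; nlinarith
  have hle := Real.log_le_log (hc.trans_le (hcF _ (Real.exp_pos _))) hF2
  rw [Real.log_mul (by positivity) hC0.ne'] at hle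
  rw [zero_add]
  refine le_trans ?_ hK
  rw [dimQuot, Real.log_exp, show (q - 1) * -(K : ℝ) = (1 - q) * K by ring]
  gcongr

theorem frequently_le_dimQuot {Λ : ℝ} (hΛ : 0 < Λ) (ψ : Hspace) {q : ℝ}
    (hq : q ∈ Ioo (0 : ℝ) 1)
    (hψ : ∃ᶠ K : ℕ in atTop, ∀ k < K,
      1 / (K * Real.log K) ≤ (specMeasure Λ ψ).real {lam Λ (k + 1)})
    {δ : ℝ} (hδ : 0 < δ) :
    ∃ᶠ ε in 𝓝[>] 0, 1 / 3 - δ ≤ dimQuot (specMeasure Λ ψ) q ε := by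
  have h1q : 0 < 1 - q := by linarith [hq.2]
  set b := Real.log (Λ / 2)
  have hpow : Tendsto (fun K : ℕ => 2 * (K : ℝ) ^ 3) atTop atTop :=
    ((tendsto_pow_atTop (by norm_num)).comp tendsto_natCast_atTop_atTop).const_mul_atTop two_pos
  have hscale : Tendsto (fun K : ℕ => Λ / (2 * (K : ℝ) ^ 3)) atTop (𝓝[>] 0) := by
    refine tendsto_nhdsWithin_iff.2 ⟨tendsto_const_nhds.div_atTop hpow, ?_⟩
    filter_upwards [eventually_ge_atTop 1] with K hK
    have : (0 : ℝ) < K := by exact_mod_cast hK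
    exact div_pos hΛ (by positivity)
  have hloglim : Tendsto (fun K : ℕ => Real.log K) atTop atTop :=
    Real.tendsto_log_atTop.comp tendsto_natCast_atTop_atTop
  have hlim : Tendsto (fun K : ℕ => ((1 - q) * Real.log K - q * Real.log (Real.log K)) /
      ((1 - q) * (3 * Real.log K - b))) atTop (𝓝 (1 / 3)) := by
    have h1 : Tendsto (fun t : ℝ => ((1 - q) - q * (Real.log t / t)) / ((1 - q) * (3 - b / t)))
        atTop (𝓝 (1 / 3)) := by
      have hnum := (tendsto_const_nhds (x := 1 - q)).sub
        ((Real.isLittleO_log_id_atTop.tendsto_div_nhds_zero).const_mul q)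
      have hden := ((tendsto_const_nhds (x := (3 : ℝ))).sub
        (tendsto_const_nhds (x := b).div_atTop tendsto_id)).const_mul (1 - q)
      have := hnum.div hden (by simpa using h1q.ne')
      convert! this using 2
      field_simp
      ring
    refine (h1.comp hloglim).congr' ?_
    filter_upwards [hloglim.eventually_gt_atTop 0] with K hK
    rw [Function.comp_apply, ← mul_div_mul_right _ _ hK.ne']
    congr 1
    · field_simp
    · field_simp
  refine hscale.frequently (hψ.mp ?_)
  filter_upwards [hlim.eventually_const_le (show 1 / 3 - δ < 1 / 3 by linarith),
    hloglim.eventually_gt_atTop 0, eventually_ge_atTop 1, hloglim.eventually_gt_atTop b]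
    with K hK hlog hK1 hb hp
  have hK0 : (0 : ℝ) < K := by exact_mod_cast hK1
  have hF := mul_rpow_le_toReal_fracIntegral hΛ ψ hq hK1 (by positivity) hp
  have hle := Real.log_le_log (by positivity) hF
  rw [Real.log_mul hK0.ne' (by positivity), Real.log_rpow (by positivity), one_div, Real.log_inv,
    Real.log_mul hK0.ne' hlog.ne'] at hle
  refine hK.trans ?_
  have hε : Real.log (Λ / (2 * (K : ℝ) ^ 3)) = b - 3 * Real.log K := by
    rw [← div_div, Real.log_div (by positivity) (by positivity), Real.log_pow]
    norm_num [b]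
  rw [dimQuot, hε, show (q - 1) * (b - 3 * Real.log K) = (1 - q) * (3 * Real.log K - b) by ring]
  have : 0 < 3 * Real.log K - b := by linarith
  gcongr
  linarith

/-- The orbital with principal quantum number `k + 1` and `l = m = 0`. -/
def sOrbital (k : ℕ) : HIndex := ⟨k + 1, 0, 0, by omega, by omega, by simp⟩

theorem sOrbital_injective : Function.Injective sOrbital := fun i j h => by
  have := congrArg HIndex.n h
  simpa [sOrbital] using this

theorem mem_residual_setOf_frequently {X : Type*} [TopologicalSpace X] {p : ℕ → X → Prop}
    (ho : ∀ K, IsOpen {x | p K x}) (hd : ∀ j, Dense (⋃ K ≥ j, {x | p K x})) :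
    {x | ∃ᶠ K in atTop, p K x} ∈ residual X := by
  have : {x | ∃ᶠ K in atTop, p K x} = ⋂ j : ℕ, ⋃ K ≥ j, {x | p K x} := by
    ext x
    simp [frequently_atTop]
  rw [this]
  exact countable_iInter_mem.2 fun j =>
    residual_of_dense_open (isOpen_biUnion fun K _ => ho K) (hd j)

/-- Vectors extremely close to the span of the first `K` energy shells. -/
theorem residual_near_finite_support (r : ℕ → ℝ) (hr : ∀ K, 0 < r K) :
    {ψ : Hspace | ∃ᶠ K in atTop,
      ∃ φ : Hspace, (∀ i : HIndex, K < i.n → φ i = 0) ∧ ‖ψ - φ‖ < r K} ∈ residual Hspace := by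
  classical
  refine mem_residual_setOf_frequently (fun K => ?_) fun j => ?_
  · have : {ψ : Hspace | ∃ φ : Hspace, (∀ i : HIndex, K < i.n → φ i = 0) ∧ ‖ψ - φ‖ < r K}
        = ⋃ φ ∈ {φ : Hspace | ∀ i : HIndex, K < i.n → φ i = 0}, Metric.ball φ (r K) := by
      ext ψ
      simp [dist_eq_norm]
    rw [this]
    exact isOpen_biUnion fun _ _ => Metric.isOpen_ball
  · rw [Metric.dense_iff]
    intro ψ ε hε
    obtain ⟨s, hs⟩ := (Metric.tendsto_nhds.1 (lp.hasSum_single ENNReal.ofNat_ne_top ψ) ε hε).exists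
    refine ⟨∑ i ∈ s, lp.single 2 i (ψ i), hs, ?_⟩
    simp only [mem_iUnion]
    refine ⟨max j (s.sup HIndex.n), le_max_left _ _, ∑ i ∈ s, lp.single 2 i (ψ i), ?_, ?_⟩
    · intro i hi
      have his : i ∉ s := fun h =>
        (((Finset.le_sup (f := HIndex.n) h).trans (le_max_right _ _)).trans_lt hi).false
      rw [lp.coeFn_sum, Finset.sum_apply]
      refine Finset.sum_eq_zero fun k hk => ?_
      exact lp.single_apply_ne 2 k _ (by rintro rfl; exact his hk)
    · rw [sub_self, norm_zero]
      exact hr _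

/-- Vectors whose first `K` components `ψ_{n,0,0}` are all larger than a threshold `t K`. -/
theorem residual_large_components (t : ℕ → ℝ) (ht : ∀ᶠ K in atTop, 0 < t K)
    (hlim : Tendsto (fun K : ℕ => K * t K) atTop (𝓝 0)) :
    {ψ : Hspace | ∃ᶠ K in atTop, ∀ k < K, t K < ‖ψ (sOrbital k)‖ ^ 2} ∈ residual Hspace := by
  classical
  refine mem_residual_setOf_frequently (fun K => ?_) fun j => ?_
  · have : {ψ : Hspace | ∀ k < K, t K < ‖ψ (sOrbital k)‖ ^ 2}
        = ⋂ k ∈ Iio K, {ψ : Hspace | t K < ‖ψ (sOrbital k)‖ ^ 2} := by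
      ext ψ
      simp
    rw [this]
    refine (finite_Iio K).isOpen_biInter fun k _ => isOpen_lt continuous_const ?_
    have : Continuous fun ψ : Hspace => ψ (sOrbital k) :=
      (continuous_apply (sOrbital k)).comp lp.uniformContinuous_coe.continuous
    exact this.norm.pow 2
  · rw [Metric.dense_iff]
    intro ψ ε hε
    have hlim9 : Tendsto (fun K : ℕ => 9 * (K * t K)) atTop (𝓝 0) := by
      simpa using hlim.const_mul 9
    obtain ⟨K, hK, htK, hjK⟩ := ((hlim9.eventually_lt_const (show 0 < ε ^ 2 by positivity)).and
      (ht.and (eventually_ge_atTop j))).exists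
    set c : HIndex → ℂ := fun i => if t K < ‖ψ i‖ ^ 2 then 0 else (3 * √(t K) : ℝ) with hc
    set s := (Finset.range K).map ⟨sOrbital, sOrbital_injective⟩ with hs
    set η : Hspace := ∑ i ∈ s, lp.single 2 i (c i)
    have hcn : ∀ i, ‖c i‖ ^ 2 ≤ 9 * t K := by
      intro i
      simp only [hc]
      split_ifs
      · simpa using htK.le
      · rw [Complex.norm_real, Real.norm_eq_abs, sq_abs, mul_pow, Real.sq_sqrt htK.le]
        norm_num
    have hη : ‖η‖ ^ 2 < ε ^ 2 := by
      have h := lp.norm_sum_single (p := 2) (by norm_num) c s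
      simp only [ENNReal.toReal_ofNat, Real.rpow_ofNat] at h
      calc ‖η‖ ^ 2 = ∑ i ∈ s, ‖c i‖ ^ 2 := h
        _ ≤ ∑ _i ∈ s, 9 * t K := Finset.sum_le_sum fun i _ => hcn i
        _ = 9 * (K * t K) := by
          rw [Finset.sum_const, hs, Finset.card_map, Finset.card_range, nsmul_eq_mul]
          ring
        _ < ε ^ 2 := hK
    refine ⟨ψ + η, ?_, ?_⟩
    · rw [Metric.mem_ball, dist_eq_norm, add_sub_cancel_left]
      exact lt_of_pow_lt_pow_left₀ 2 hε.le hη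
    · simp only [mem_iUnion]
      refine ⟨K, hjK, fun k hk => ?_⟩
      have hmem : sOrbital k ∈ s := by
        simpa [hs] using hk
      have hηk : η (sOrbital k) = c (sOrbital k) := by
        simp only [η, lp.coeFn_sum, Finset.sum_apply, lp.coeFn_single, Finset.sum_pi_single,
          if_pos hmem]
      rw [lp.coeFn_add, Pi.add_apply, hηk]
      simp only [hc]
      split_ifs with h
      · simpa using h
      · have hs0 : 0 < √(t K) := Real.sqrt_pos.2 htK
        have hψ : ‖ψ (sOrbital k)‖ ≤ √(t K) := Real.le_sqrt_of_sq_le (not_lt.1 h)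
        have h3 : ‖((3 * √(t K) : ℝ) : ℂ)‖ = 3 * √(t K) := by
          rw [Complex.norm_real, Real.norm_of_nonneg (by positivity)]
        have htri := norm_sub_norm_le ((3 * √(t K) : ℝ) : ℂ) (-ψ (sOrbital k))
        rw [h3, norm_neg, sub_neg_eq_add, add_comm (_ : ℂ)] at htri
        have h2 : 2 * √(t K) ≤ ‖ψ (sOrbital k) + ((3 * √(t K) : ℝ) : ℂ)‖ := by linarith
        calc t K < (2 * √(t K)) ^ 2 := by rw [mul_pow, Real.sq_sqrt htK.le]; linarith
          _ ≤ _ := by gcongr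

theorem hydrogen_generic_fractal_dimensions (Λ : ℝ) (hΛ : 0 < Λ) :
    ∃ R : Set Hspace, R ∈ residual Hspace ∧
      ∀ ψ ∈ R, ∀ q ∈ Ioo (0 : ℝ) 1,
        Dlower (specMeasure Λ ψ) q = 0 ∧ Dupper (specMeasure Λ ψ) q = 1 / 3 := by
  have hloglim : Tendsto (fun K : ℕ => Real.log K) atTop atTop :=
    Real.tendsto_log_atTop.comp tendsto_natCast_atTop_atTop
  have hpos : ∀ᶠ K : ℕ in atTop, 0 < 1 / (K * Real.log K) := by
    filter_upwards [hloglim.eventually_gt_atTop 0, eventually_ge_atTop 1] with K h hK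
    have : (0 : ℝ) < K := by exact_mod_cast hK
    positivity
  have hlim : Tendsto (fun K : ℕ => K * (1 / (K * Real.log K))) atTop (𝓝 0) := by
    refine (tendsto_inv_atTop_zero.comp hloglim).congr' ?_
    filter_upwards [eventually_ge_atTop 1] with K hK
    have : (K : ℝ) ≠ 0 := by exact_mod_cast (by omega : K ≠ 0)
    rw [Function.comp_apply]
    field_simp
  refine ⟨_, inter_mem (residual_near_finite_support (fun K => Real.exp (-(K : ℝ) ^ 2))
    fun K => Real.exp_pos _) (residual_large_components _ hpos hlim), ?_⟩
  rintro ψ ⟨hG, hH⟩ q hq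
  have hG' : ∃ᶠ K : ℕ in atTop,
      (specMeasure Λ ψ).real (Ioi (lam Λ K)) ≤ Real.exp (-(K : ℝ) ^ 2) := by
    refine Frequently.mono hG ?_
    rintro K ⟨φ, hφ, hψφ⟩
    refine ENNReal.toReal_le_of_le_ofReal (Real.exp_pos _).le
      ((specMeasure_Ioi_le hΛ ψ φ hφ).trans (ENNReal.ofReal_le_ofReal ?_))
    have h1 : Real.exp (-(K : ℝ) ^ 2) ≤ 1 := Real.exp_le_one_iff.2 (by nlinarith)
    nlinarith [norm_nonneg (ψ - φ)]
  have hH' : ∃ᶠ K : ℕ in atTop, ∀ k < K,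
      1 / (K * Real.log K) ≤ (specMeasure Λ ψ).real {lam Λ (k + 1)} := by
    refine Frequently.mono hH fun K hK k hk => (hK k hk).le.trans ?_
    exact (ENNReal.ofReal_le_iff_le_toReal (measure_ne_top _ _)).1
      (ofReal_norm_sq_le_specMeasure Λ ψ (sOrbital k))
  have hx : 0 < specMeasure Λ ψ {lam Λ 1} := by
    obtain ⟨K, hK, hK0, hK1⟩ := (hH.and_eventually (hpos.and (eventually_ge_atTop 1))).exists
    exact (ENNReal.ofReal_pos.2 (hK0.trans (hK 0 hK1))).trans_le
      (ofReal_norm_sq_le_specMeasure Λ ψ (sOrbital 0))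
  exact ⟨liminf_eq_of_eventually_of_frequently
      (fun δ hδ => eventually_le_dimQuot hΛ ψ hq hx hδ)
      (fun δ hδ => frequently_dimQuot_le hΛ ψ hq hx hG' hδ),
    limsup_eq_of_eventually_of_frequently
      (fun δ hδ => eventually_dimQuot_le hΛ ψ hq hx hδ)
      (fun δ hδ => frequently_le_dimQuot hΛ ψ hq hH' hδ)⟩
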